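/- arXiv:2210.17405 — 3 statements merged into one kernel-verified Lean document; each statement's English description precedes it below -/
import Mathlib

section
/- Let y₀ = (1, 0) ∈ ℝ², let T₁ be the 2×2 real matrix with rows (−1, −1) and (−1, 0), and let T₂ be the 2×2 real matrix with rows (0, −1) and (0, 1). Then the set E = {h ∈ ℝ² : ‖T₂·h‖₂ ≤ ‖y₀ − T₁·h‖₂} is not convex. Concretely, the points (−1, 1) and (1, 5) belong to E but their midpoint (0, 3) does not. -/
/-- Comparing the Euclidean norms of `T₂ h` and `y₀ - T₁ h` amounts to a quadratic inequality
in the coordinates of `h`. -/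
theorem norm_toEuclideanLin_le_norm_sub_iff (h : EuclideanSpace ℝ (Fin 2)) :
    ‖Matrix.toEuclideanLin (!![0, -1; 0, 1] : Matrix (Fin 2) (Fin 2) ℝ) h‖ ≤
        ‖(WithLp.equiv 2 (Fin 2 → ℝ)).symm ![1, 0] -
          Matrix.toEuclideanLin (!![-1, -1; -1, 0] : Matrix (Fin 2) (Fin 2) ℝ) h‖ ↔
      2 * h 1 ^ 2 ≤ (1 + h 0 + h 1) ^ 2 + h 0 ^ 2 := by
  rw [← sq_le_sq₀ (norm_nonneg _) (norm_nonneg _), EuclideanSpace.real_norm_sq_eq,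
    EuclideanSpace.real_norm_sq_eq]
  simp [Fin.sum_univ_two, Matrix.toLpLin_apply, dotProduct]
  ring_nf

/-- The paper's counterexample: with `y₀ = (1,0)`, `T₁ = [[-1,-1],[-1,0]]`,
`T₂ = [[0,-1],[0,1]]`, the region `E = {h : ‖T₂ h‖₂ ≤ ‖y₀ − T₁ h‖₂}` is not convex;
concretely `(−1,1)` and `(1,5)` lie in `E` but their midpoint `(0,3)` does not. -/
theorem intersection_region_not_convex :
    let y₀ : EuclideanSpace ℝ (Fin 2) := (WithLp.equiv 2 (Fin 2 → ℝ)).symm ![1, 0]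
    let T₁ : Matrix (Fin 2) (Fin 2) ℝ := !![-1, -1; -1, 0]
    let T₂ : Matrix (Fin 2) (Fin 2) ℝ := !![0, -1; 0, 1]
    let E : Set (EuclideanSpace ℝ (Fin 2)) :=
      {h | ‖Matrix.toEuclideanLin T₂ h‖ ≤ ‖y₀ - Matrix.toEuclideanLin T₁ h‖}
    let p : EuclideanSpace ℝ (Fin 2) := (WithLp.equiv 2 (Fin 2 → ℝ)).symm ![-1, 1]
    let q : EuclideanSpace ℝ (Fin 2) := (WithLp.equiv 2 (Fin 2 → ℝ)).symm ![1, 5]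
    ¬ Convex ℝ E ∧ p ∈ E ∧ q ∈ E ∧ midpoint ℝ p q ∉ E := by
  intro y₀ T₁ T₂ E p q
  have mem_iff (h : EuclideanSpace ℝ (Fin 2)) :
      h ∈ E ↔ 2 * h 1 ^ 2 ≤ (1 + h 0 + h 1) ^ 2 + h 0 ^ 2 :=
    norm_toEuclideanLin_le_norm_sub_iff h
  have hp : p ∈ E := by
    rw [mem_iff]
    norm_num [p]
  have hq : q ∈ E := by
    rw [mem_iff]
    norm_num [q]
  have hm : midpoint ℝ p q ∉ E := by
    rw [mem_iff]
    norm_num [p, q, midpoint_eq_smul_add]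
  exact ⟨fun hE => hm (hE.midpoint_mem hp hq), hp, hq, hm⟩
end

section
/- (Proposition 3, score-level form.) Let n ≥ 1 and let μ be a probability measure on ℝⁿ⁺¹ (viewed as functions Fin(n+1) → ℝ) that is exchangeable, i.e., invariant under the pushforward by every coordinate permutation, and assume that μ-almost surely all n+1 coordinates are pairwise distinct. Then for every subset T ⊆ {1,…,n}, μ({s ∈ ℝⁿ⁺¹ : ∃ i ∈ T, s_{n+1} ≤ s_i}) ≥ |T|/(n+1). -/
open MeasureTheory

/-- Under an exchangeable law, each of the `#S` coordinates in `S` is the strict maximum over `S`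
with probability at most `1 / #S`. -/
theorem card_mul_measureReal_strictMax_le_one {ι : Type*}
    (μ : Measure (ι → ℝ)) [IsProbabilityMeasure μ]
    (hexch : ∀ σ : Equiv.Perm ι, Measure.map (fun s => s ∘ σ) μ = μ)
    (S : Finset ι) {l : ι} (hl : l ∈ S) :
    (S.card : ℝ) * μ.real {s | ∀ i ∈ S, i ≠ l → s i < s l} ≤ 1 := by
  classical
  let A : ι → Set (ι → ℝ) := fun j => {s | ∀ i ∈ S, i ≠ j → s i < s j}
  have hmeas (j : ι) : MeasurableSet (A j) := by
    have hA : A j = ⋂ i ∈ S, {s | i ≠ j → s i < s j} := by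
      ext s
      simp [A]
    rw [hA]
    refine S.measurableSet_biInter fun i _ => ?_
    by_cases h : i = j
    · simp [h]
    · simpa [h] using measurableSet_lt (measurable_pi_apply i) (measurable_pi_apply j)
  have hswap : ∀ j ∈ S, μ.real (A j) = μ.real (A l) := by
    intro j hj
    have hpre : (fun s : ι → ℝ => s ∘ Equiv.swap j l) ⁻¹' A j = A l := by
      have hmem (i : ι) (hi : i ∈ S) : Equiv.swap j l i ∈ S := by
        rw [Equiv.swap_apply_def]
        split_ifs <;> assumption
      ext s
      simp only [A, Set.mem_preimage, Set.mem_ofPred_eq, Function.comp_apply,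
        Equiv.swap_apply_left]
      constructor
      · intro h i hi hil
        have := h (Equiv.swap j l i) (hmem i hi) fun h' =>
          hil (by simpa using congrArg (Equiv.swap j l) h')
        simpa using this
      · intro h i hi hij
        exact h _ (hmem i hi) fun h' => hij (by simpa using congrArg (Equiv.swap j l) h')
    have hm : Measurable fun s : ι → ℝ => s ∘ Equiv.swap j l :=
      measurable_pi_lambda _ fun i => measurable_pi_apply _
    rw [← hpre, ← map_measureReal_apply hm (hmeas j), hexch]
  have hdisj : (S : Set ι).PairwiseDisjoint A := by
    intro i hi j hj hij
    refine Set.disjoint_left.2 fun s hsi hsj => ?_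
    exact lt_asymm (hsi j hj hij.symm) (hsj i hi hij)
  calc (S.card : ℝ) * μ.real (A l) = ∑ j ∈ S, μ.real (A j) := by
        rw [Finset.sum_congr rfl hswap, Finset.sum_const, nsmul_eq_mul]
    _ = μ.real (⋃ j ∈ S, A j) :=
        (measureReal_biUnion_finset hdisj fun j _ => hmeas j).symm
    _ ≤ 1 := measureReal_le_one

/-- Proposition 3 (score-level form): if the joint law `μ` of the `n+1` conformity
scores is exchangeable and the scores are almost surely pairwise distinct, then for
every set `T` of non-test indices,
`μ({s : ∃ i ∈ T, s_{n+1} ≤ s_i}) ≥ |T|/(n+1)`. -/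
theorem conformal_union_coverage
    (n : ℕ) (hn : 1 ≤ n)
    (μ : Measure (Fin (n + 1) → ℝ)) [IsProbabilityMeasure μ]
    (hexch : ∀ σ : Equiv.Perm (Fin (n + 1)),
      Measure.map (fun s => s ∘ σ) μ = μ)
    (hdistinct : ∀ᵐ s ∂μ, Function.Injective s)
    (T : Finset (Fin (n + 1))) (hT : Fin.last n ∉ T) :
    (T.card : ENNReal) / (n + 1) ≤ μ {s | ∃ i ∈ T, s (Fin.last n) ≤ s i} := by
  set E : Set (Fin (n + 1) → ℝ) := {s | ∃ i ∈ T, s (Fin.last n) ≤ s i}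
  have hE : MeasurableSet E := by
    have hE' : E = ⋃ i ∈ T, {s | s (Fin.last n) ≤ s i} := by
      ext s
      simp [E]
    rw [hE']
    exact T.measurableSet_biUnion fun i _ =>
      measurableSet_le (measurable_pi_apply _) (measurable_pi_apply i)
  have hcompl : {s : Fin (n + 1) → ℝ | ∀ i ∈ insert (Fin.last n) T,
      i ≠ Fin.last n → s i < s (Fin.last n)} = Eᶜ := by
    ext s
    simp only [E, Set.mem_ofPred_eq, Set.mem_compl_iff, not_exists, not_and, not_le]
    constructor
    · exact fun h i hi => h i (Finset.mem_insert_of_mem hi) (ne_of_mem_of_not_mem hi hT)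
    · exact fun h i hi hne => h i (Finset.mem_of_mem_insert_of_ne hi hne)
  have hmax := card_mul_measureReal_strictMax_le_one μ hexch _
    (Finset.mem_insert_self (Fin.last n) T)
  have hcard := Finset.card_le_univ (insert (Fin.last n) T)
  rw [Finset.card_insert_of_notMem hT, Fintype.card_fin] at hcard
  rw [hcompl, Finset.card_insert_of_notMem hT, probReal_compl_eq_one_sub hE] at hmax
  push_cast at hmax
  have hle : (T.card : ℝ) + 1 ≤ n + 1 := by exact_mod_cast hcard
  have hreal : (T.card : ℝ) ≤ μ.real E * (n + 1) := by
    nlinarith [measureReal_nonneg (μ := μ) (s := E)]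
  refine ENNReal.div_le_of_le_mul ?_
  rw [← ENNReal.toReal_le_toReal (by finiteness) (by finiteness), ENNReal.toReal_mul,
    ENNReal.toReal_add (by finiteness) (by finiteness)]
  simpa [Measure.real] using hreal
end

section
/- Let n ≥ 1 and let μ be a probability measure on ℝⁿ⁺¹ (viewed as functions Fin(n+1) → ℝ) that is exchangeable, i.e., invariant under the pushforward by every coordinate permutation, and assume that μ-almost surely all n+1 coordinates are pairwise distinct. Define the conformal p-value p(s) = |{i ∈ {1,…,n+1} : s_i ≥ s_{n+1}}|/(n+1). Then for every α ∈ [0, 1], μ({s : p(s) ≤ α}) ≤ α. -/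
open MeasureTheory

/-- At most `c` indices `j` have at most `c` entries that are at least the `j`-th one. -/
theorem card_filter_card_filter_le_le {ι : Type*} [Fintype ι] (s : ι → ℝ) {c : ℝ} (hc : 0 ≤ c) :
    ((Finset.univ.filter fun j =>
      ((Finset.univ.filter fun i => s j ≤ s i).card : ℝ) ≤ c).card : ℝ) ≤ c := by
  set J := Finset.univ.filter fun j => ((Finset.univ.filter fun i => s j ≤ s i).card : ℝ) ≤ c
    with hJ
  rcases J.eq_empty_or_nonempty with h | h
  · simpa [h] using hc
  · obtain ⟨j, hj, hmin⟩ := J.exists_min_image s h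
    have hsub : J ⊆ Finset.univ.filter fun i => s j ≤ s i := fun i hi => by
      simpa using hmin i hi
    exact (Nat.cast_le.mpr (Finset.card_le_card hsub)).trans (Finset.mem_filter.mp hj).2

theorem measurableSet_card_filter_le {ι : Type*} [Fintype ι] (c : ℝ) (j : ι) :
    MeasurableSet {s : ι → ℝ | ((Finset.univ.filter fun i => s j ≤ s i).card : ℝ) ≤ c} := by
  simp only [Finset.card_filter, Nat.cast_sum]
  refine measurableSet_le (Finset.measurable_sum _ fun i _ => ?_) measurable_const
  refine measurable_from_nat.comp (Measurable.ite ?_ measurable_const measurable_const)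
  exact measurableSet_le (measurable_pi_apply j) (measurable_pi_apply i)

/-- Under an exchangeable law, the events that a given coordinate has at most `c` entries at
least as large are equally likely. -/
theorem measure_card_filter_le_eq {ι : Type*} [Fintype ι] {μ : Measure (ι → ℝ)}
    (hexch : ∀ σ : Equiv.Perm ι, Measure.map (fun s => s ∘ σ) μ = μ) (c : ℝ) (j k : ι) :
    μ {s | ((Finset.univ.filter fun i => s j ≤ s i).card : ℝ) ≤ c} =
      μ {s | ((Finset.univ.filter fun i => s k ≤ s i).card : ℝ) ≤ c} := by
  classical
  have hmeas : Measurable fun s : ι → ℝ => s ∘ Equiv.swap j k :=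
    measurable_pi_lambda _ fun i => measurable_pi_apply _
  conv_rhs => rw [← hexch (Equiv.swap j k), Measure.map_apply hmeas
    (measurableSet_card_filter_le c k)]
  congr 1
  ext s
  have hcard : (Finset.univ.filter fun i => s j ≤ s (Equiv.swap j k i)).card =
      (Finset.univ.filter fun i => s j ≤ s i).card :=
    Finset.card_equiv (Equiv.swap j k) fun i => by simp
  simp [hcard]

/-- Super-uniformity of the conformal p-value: if the joint law `μ` of the `n+1`
conformity scores is exchangeable and the scores are almost surely pairwise
distinct, then `p(s) = |{i : s_i ≥ s_{n+1}}|/(n+1)` satisfies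
`μ(p(s) ≤ α) ≤ α` for every `α ∈ [0,1]`. -/
theorem conformal_pvalue_super_uniform
    (n : ℕ) (hn : 1 ≤ n)
    (μ : Measure (Fin (n + 1) → ℝ)) [IsProbabilityMeasure μ]
    (hexch : ∀ σ : Equiv.Perm (Fin (n + 1)),
      Measure.map (fun s => s ∘ σ) μ = μ)
    (hdistinct : ∀ᵐ s ∂μ, Function.Injective s) :
    ∀ α ∈ Set.Icc (0 : ℝ) 1,
      μ {s | ((Finset.univ.filter
            (fun i : Fin (n + 1) => s (Fin.last n) ≤ s i)).card : ℝ) / (n + 1) ≤ α}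
        ≤ ENNReal.ofReal α := by
  intro α hα
  have hn0 : (0 : ℝ) < n + 1 := by positivity
  simp only [div_le_iff₀ hn0]
  set c : ℝ := α * (n + 1) with hc
  have hc0 : 0 ≤ c := mul_nonneg hα.1 hn0.le
  let A : Fin (n + 1) → Set (Fin (n + 1) → ℝ) := fun j =>
    {s | ((Finset.univ.filter fun i => s j ≤ s i).card : ℝ) ≤ c}
  have hA : ∀ j, MeasurableSet (A j) := measurableSet_card_filter_le c
  have hsum : ∑ j, μ (A j) ≤ ENNReal.ofReal c := calc
    ∑ j, μ (A j) = ∫⁻ s, ∑ j, (A j).indicator 1 s ∂μ := by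
      rw [lintegral_finsetSum _ fun j _ => measurable_one.indicator (hA j)]
      simp [lintegral_indicator_one (hA _)]
    _ ≤ ∫⁻ _, ENNReal.ofReal c ∂μ := by
      refine lintegral_mono fun s => ?_
      have h := ENNReal.ofReal_le_ofReal (card_filter_card_filter_le_le s hc0)
      rw [ENNReal.ofReal_natCast] at h
      simpa [A, Set.indicator_apply, Finset.sum_boole] using h
    _ = ENNReal.ofReal c := by simp
  have hconst : ∑ j, μ (A j) = μ (A (Fin.last n)) * ENNReal.ofReal (n + 1) := by
    rw [Finset.sum_congr rfl fun j _ => measure_card_filter_le_eq hexch c j (Fin.last n)]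
    rw [Finset.sum_const, Finset.card_univ, Fintype.card_fin, nsmul_eq_mul, mul_comm]
    rw [← Nat.cast_add_one, ENNReal.ofReal_natCast]
  rw [hconst, hc, ENNReal.ofReal_mul hα.1] at hsum
  exact (ENNReal.mul_le_mul_iff_left (ENNReal.ofReal_pos.mpr hn0).ne' ENNReal.ofReal_ne_top).mp hsum
end
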